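/- Run HPMD with 1 + η_k·τ_k = 1/γ and η_k = γ^{−2(k+1)}, and assume |c(s,a)| ≤ C for all (s,a). Then for every k ≥ K₁ := 3·log_γ( Δ*(M)·(1−γ) / (2ϱ·(4·log|A| + C)) ): V^{π_{k+1}}(s) − V*(s) ≤ (2·C·|A|·C_γ/(1−γ)²)·exp( −Δ*(M)·γ^{−2k−1}/2 ) for every s ∈ S, and consequently f(π_{k+1}) − f(π*) ≤ (2·C·|A|·C_γ/(1−γ)²)·exp( −Δ*(M)·γ^{−2k−1}/2 ), where C_γ = exp( 2C / ((1−γ³)(1−γ)γ) ) and log_γ x = log x / log γ. -/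

import Mathlib

/-- A probability distribution on a finite set: nonnegative and sums to 1. -/
def IsDist {A : Type*} [Fintype A] (p : A → ℝ) : Prop :=
  (∀ a, 0 ≤ p a) ∧ ∑ a, p a = 1

/-- A (randomized, stationary) policy. -/
def IsPolicy {S A : Type*} [Fintype A] (π : S → A → ℝ) : Prop :=
  ∀ s, IsDist (π s)

/-- Kullback–Leibler divergence on a finite set (0·log 0 = 0). -/
noncomputable def KL {A : Type*} [Fintype A] (p q : A → ℝ) : ℝ :=
  ∑ a, p a * Real.log (p a / q a)

/-- The Q-function induced by a value function `V`. -/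
noncomputable def Qf {S A : Type*} [Fintype S] (γ : ℝ) (c : S → A → ℝ)
    (P : S → A → S → ℝ) (V : S → ℝ) (s : S) (a : A) : ℝ :=
  c s a + γ * ∑ s', P s a s' * V s'

/-- Minimal Q-value at a state. -/
noncomputable def Qmin {S A : Type*} [Fintype A] [Nonempty A] (Q : S → A → ℝ) (s : S) : ℝ :=
  Finset.univ.inf' Finset.univ_nonempty (Q s)

section Distributions

variable {A : Type*} [Fintype A]

lemma IsDist.le_one {p : A → ℝ} (hp : IsDist p) (a : A) : p a ≤ 1 := by
  rw [← hp.2]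
  exact Finset.single_le_sum (fun b _ => hp.1 b) (Finset.mem_univ a)

/-- The mean of a function bounded above is bounded above. -/
lemma IsDist.sum_mul_le {p : A → ℝ} (hp : IsDist p) {h : A → ℝ} {b : ℝ} (hb : ∀ a, h a ≤ b) :
    ∑ a, p a * h a ≤ b := by
  calc ∑ a, p a * h a ≤ ∑ a, p a * b :=
        Finset.sum_le_sum fun a _ => mul_le_mul_of_nonneg_left (hb a) (hp.1 a)
    _ = b := by rw [← Finset.sum_mul, hp.2, one_mul]

lemma IsDist.le_sum_mul {p : A → ℝ} (hp : IsDist p) {h : A → ℝ} {b : ℝ} (hb : ∀ a, b ≤ h a) :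
    b ≤ ∑ a, p a * h a := by
  calc b = ∑ a, p a * b := by rw [← Finset.sum_mul, hp.2, one_mul]
    _ ≤ ∑ a, p a * h a :=
        Finset.sum_le_sum fun a _ => mul_le_mul_of_nonneg_left (hb a) (hp.1 a)

lemma IsDist.sum_mul_sub {p : A → ℝ} (hp : IsDist p) (h : A → ℝ) (b : ℝ) :
    ∑ a, p a * (h a - b) = ∑ a, p a * h a - b := by
  simp only [mul_sub, Finset.sum_sub_distrib, ← Finset.sum_mul, hp.2, one_mul]

lemma KL_eq_sub {p q : A → ℝ} (hq : ∀ a, 0 < q a) :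
    KL p q = ∑ a, p a * Real.log (p a) - ∑ a, p a * Real.log (q a) := by
  rw [KL, ← Finset.sum_sub_distrib]
  refine Finset.sum_congr rfl fun a _ => ?_
  rcases eq_or_ne (p a) 0 with h | h
  · simp [h]
  · rw [Real.log_div h (hq a).ne', mul_sub]

lemma KL_eq_sum_klFun {p q : A → ℝ} (hp : IsDist p) (hq : IsDist q) (hpos : ∀ a, 0 < q a) :
    KL p q = ∑ a, q a * InformationTheory.klFun (p a / q a) := by
  have h : ∀ a, q a * InformationTheory.klFun (p a / q a)
      = p a * Real.log (p a / q a) + (q a - p a) := by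
    intro a
    have := (hpos a).ne'
    rw [InformationTheory.klFun]
    field_simp
    ring
  simp only [h, Finset.sum_add_distrib, Finset.sum_sub_distrib, hp.2, hq.2, KL]
  ring

lemma KL_nonneg {p q : A → ℝ} (hp : IsDist p) (hq : IsDist q) (hpos : ∀ a, 0 < q a) :
    0 ≤ KL p q := by
  rw [KL_eq_sum_klFun hp hq hpos]
  exact Finset.sum_nonneg fun a _ => mul_nonneg (hpos a).le
    (InformationTheory.klFun_nonneg (div_nonneg (hp.1 a) (hpos a).le))

lemma KL_self {p : A → ℝ} (hpos : ∀ a, 0 < p a) : KL p p = 0 := by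
  rw [KL_eq_sub hpos, sub_self]

lemma eq_of_KL_nonpos {p q : A → ℝ} (hp : IsDist p) (hq : IsDist q) (hpos : ∀ a, 0 < q a)
    (h : KL p q ≤ 0) : p = q := by
  have hn : ∀ a ∈ Finset.univ, 0 ≤ q a * InformationTheory.klFun (p a / q a) := fun a _ =>
    mul_nonneg (hpos a).le (InformationTheory.klFun_nonneg (div_nonneg (hp.1 a) (hpos a).le))
  have h0 := h.antisymm (KL_nonneg hp hq hpos)
  rw [KL_eq_sum_klFun hp hq hpos, Finset.sum_eq_zero_iff_of_nonneg hn] at h0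
  funext a
  have h1 := (mul_eq_zero.1 (h0 a (Finset.mem_univ a))).resolve_left (hpos a).ne'
  rw [InformationTheory.klFun_eq_zero_iff (div_nonneg (hp.1 a) (hpos a).le),
    div_eq_one_iff_eq (hpos a).ne'] at h1
  exact h1

lemma IsDist.sum_mul_log_nonpos {p : A → ℝ} (hp : IsDist p) :
    ∑ a, p a * Real.log (p a) ≤ 0 :=
  Finset.sum_nonpos fun a _ =>
    mul_nonpos_of_nonneg_of_nonpos (hp.1 a) (Real.log_nonpos (hp.1 a) (hp.le_one a))

/-- The entropy is at most the logarithm of the cardinality. -/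
lemma IsDist.neg_log_card_le [Nonempty A] {p : A → ℝ} (hp : IsDist p) :
    -Real.log (Fintype.card A) ≤ ∑ a, p a * Real.log (p a) := by
  have hc : (0 : ℝ) < Fintype.card A := by exact_mod_cast Fintype.card_pos
  have hu : IsDist (fun _ : A => 1 / (Fintype.card A : ℝ)) :=
    ⟨fun _ => by positivity, by simp [hc.ne']⟩
  have h := KL_nonneg hp hu (fun _ => by positivity)
  rw [KL_eq_sub (fun _ => by positivity), ← Finset.sum_mul, hp.2, one_div, Real.log_inv] at h
  linarith

/-- Gibbs variational principle: a minimizer of the doubly regularized linear functional is a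
geometric mixture of the two reference distributions, tilted by the linear part. -/
lemma exists_log_eq_of_isMinimizer [Nonempty A] {γ η τ u : ℝ} (hγ : 0 < γ) (hu : 0 < u)
    (hparam : 1 + η * τ = 1 / γ) (Q q q' u' : A → ℝ) (hu' : ∀ a, u' a = u)
    (hq : ∀ a, 0 < q a) (hq' : IsDist q')
    (hmin : ∀ p : A → ℝ, IsDist p →
      η * ((∑ a, Q a * q' a) + τ * KL q' u') + KL q' q ≤
      η * ((∑ a, Q a * p a) + τ * KL p u') + KL p q) :
    (∀ a, 0 < q' a) ∧
      ∃ κ : ℝ, ∀ a, Real.log (q' a) = γ * (Real.log (q a) - η * Q a) + κ := by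
  set e : A → ℝ := fun a => Real.exp (γ * (Real.log (q a) - η * Q a)) with he
  set Z : ℝ := ∑ a, e a with hZ
  have hZpos : 0 < Z := Finset.sum_pos (fun a _ => Real.exp_pos _) Finset.univ_nonempty
  set g : A → ℝ := fun a => e a / Z with hg
  have hgpos : ∀ a, 0 < g a := fun a => div_pos (Real.exp_pos _) hZpos
  have hgdist : IsDist g :=
    ⟨fun a => (hgpos a).le, by simp only [hg, ← Finset.sum_div, ← hZ, div_self hZpos.ne']⟩
  have hlog : ∀ a, Real.log (g a) = γ * (Real.log (q a) - η * Q a) + -Real.log Z := by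
    intro a
    simp only [hg, he]
    rw [Real.log_div (Real.exp_pos _).ne' hZpos.ne', Real.log_exp]
    ring
  have hF : ∀ p : A → ℝ, IsDist p → γ * (η * ((∑ a, Q a * p a) + τ * KL p u') + KL p q)
      = KL p g - Real.log Z - γ * (η * τ) * Real.log u := by
    intro p hp
    have hητ : γ * (η * τ) = 1 - γ := by
      field_simp at hparam
      linarith
    have h1 : KL p u' = ∑ a, p a * Real.log (p a) - Real.log u := by
      rw [KL_eq_sub (fun a => by rw [hu' a]; exact hu)]
      simp only [hu', ← Finset.sum_mul, hp.2, one_mul]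
    have h2 : ∑ a, p a * Real.log (g a)
        = γ * (∑ a, p a * Real.log (q a) - η * ∑ a, Q a * p a) - Real.log Z := by
      have : ∀ a, p a * Real.log (g a)
          = γ * (p a * Real.log (q a) - η * (Q a * p a)) - p a * Real.log Z := by
        intro a; rw [hlog]; ring
      simp only [this, Finset.sum_sub_distrib, ← Finset.mul_sum, ← Finset.sum_mul, hp.2, one_mul]
    rw [KL_eq_sub hgpos, KL_eq_sub hq, h1, h2]
    linear_combination (∑ a, p a * Real.log (p a)) * hητ
  have hle : KL q' g ≤ 0 := by
    have h := mul_le_mul_of_nonneg_left (hmin g hgdist) hγ.le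
    rw [hF g hgdist, hF q' hq', KL_self hgpos] at h
    linarith
  have heq := eq_of_KL_nonpos hq' hgdist hgpos hle
  rw [heq]
  exact ⟨hgpos, _, hlog⟩

/-- Three-point inequality for one entropy-regularized mirror descent step. -/
lemma mirror_step_le [Nonempty A] {γ η κ : ℝ} (hγ : 0 < γ) (hγ1 : γ < 1)
    {Q q q' p : A → ℝ} (hq : ∀ a, 0 < q a) (hqd : IsDist q) (hq' : ∀ a, 0 < q' a)
    (hq'd : IsDist q') (hp : IsDist p)
    (hlog : ∀ a, Real.log (q' a) = γ * (Real.log (q a) - η * Q a) + κ) :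
    γ * η * (∑ a, q' a * Q a - ∑ a, p a * Q a) ≤
      (1 - γ) * Real.log (Fintype.card A) + γ * KL p q - KL p q' := by
  have key : ∀ x : A → ℝ, IsDist x → ∑ a, x a * Real.log (q' a)
      = γ * (∑ a, x a * Real.log (q a)) - γ * η * (∑ a, x a * Q a) + κ := by
    intro x hx
    have : ∀ a, x a * Real.log (q' a)
        = γ * (x a * Real.log (q a)) - γ * η * (x a * Q a) + x a * κ := by
      intro a; rw [hlog]; ring
    simp only [this, Finset.sum_add_distrib, Finset.sum_sub_distrib, ← Finset.mul_sum,
      ← Finset.sum_mul, hx.2, one_mul]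
  have h1 := key q' hq'd
  have h2 := key p hp
  have h3 := KL_nonneg hq'd hqd hq
  rw [KL_eq_sub hq] at h3
  rw [KL_eq_sub hq, KL_eq_sub hq']
  have h4 := hp.sum_mul_log_nonpos
  have h5 := hq'd.neg_log_card_le
  nlinarith

end Distributions

section Scalars

/-- A discounted recursion with geometrically decaying perturbation decays geometrically. -/
lemma le_geom_of_recursion {γ L : ℝ} (hγ : 0 < γ) (hγ1 : γ < 1) (hL : 0 ≤ L) {E : ℕ → ℝ}
    (hE : ∀ k, E (k + 1) ≤ γ * E k + γ ^ (2 * k + 1) * L) (k : ℕ) :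
    E k ≤ γ ^ k * (E 0 + L / (1 - γ)) := by
  have h1 : 0 < 1 - γ := by linarith
  have key : ∀ k, E k ≤ γ ^ k * (E 0 + L * ((1 - γ ^ k) / (1 - γ))) := by
    intro k
    induction k with
    | zero => simp
    | succ k ih =>
      refine (hE k).trans ?_
      have h2 : (1 - γ ^ (k + 1)) / (1 - γ) = (1 - γ ^ k) / (1 - γ) + γ ^ k := by
        field_simp
        ring
      rw [h2]
      calc γ * E k + γ ^ (2 * k + 1) * L
          ≤ γ * (γ ^ k * (E 0 + L * ((1 - γ ^ k) / (1 - γ)))) + γ ^ (2 * k + 1) * L := by gcongr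
        _ = _ := by ring
  refine (key k).trans ?_
  have : (1 - γ ^ k) / (1 - γ) ≤ 1 / (1 - γ) := by
    gcongr
    linarith [pow_pos hγ k]
  calc _ ≤ γ ^ k * (E 0 + L * (1 / (1 - γ))) := by gcongr
    _ = _ := by ring

/-- A sum with weights `γ ^ (k - 1 - 3 i)`, whose terms of nonnegative exponent are bounded below
and whose other terms are nonnegative, is bounded below by a geometric series. -/
lemma neg_le_sum_zpow {γ M : ℝ} (hγ : 0 < γ) (hγ1 : γ < 1) (hM : 0 ≤ M) (k : ℕ) {D : ℕ → ℝ}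
    (hD : ∀ i, -M ≤ D i) (n : ℕ) (hD0 : ∀ i < n, k ≤ 3 * i → 0 ≤ D i) :
    -(M / (1 - γ ^ 3)) ≤ ∑ i ∈ Finset.range n, γ ^ ((k : ℤ) - 1 - 3 * i) * D i := by
  have h3 : 0 < 1 - γ ^ 3 := by
    have := pow_lt_one₀ hγ.le hγ1 (n := 3) (by norm_num)
    linarith
  suffices h : -(M / (1 - γ ^ 3)) ≤ ∑ i ∈ Finset.range n, γ ^ ((k : ℤ) - 1 - 3 * i) * D i ∧
      (3 * n ≤ k + 2 → -(M / (1 - γ ^ 3)) * γ ^ ((k : ℤ) + 2 - 3 * n) ≤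
        ∑ i ∈ Finset.range n, γ ^ ((k : ℤ) - 1 - 3 * i) * D i) from h.1
  induction n with
  | zero =>
    have : 0 ≤ M / (1 - γ ^ 3) := by positivity
    have h5 : 0 ≤ γ ^ ((k : ℤ) + 2 - 3 * (0 : ℕ)) := by positivity
    simp only [Finset.range_zero, Finset.sum_empty]
    exact ⟨by linarith, fun _ => mul_nonpos_of_nonpos_of_nonneg (by linarith) h5⟩
  | succ n ih =>
    obtain ⟨ih1, ih2⟩ := ih fun i hi => hD0 i (by omega)
    rw [Finset.sum_range_succ]
    have hw : 0 < γ ^ ((k : ℤ) - 1 - 3 * n) := by positivity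
    rcases le_or_gt k (3 * n) with hk | hk
    · refine ⟨?_, fun h => by omega⟩
      have := mul_nonneg hw.le (hD0 n (by omega) hk)
      linarith
    · have hs := ih2 (by omega)
      have e1 : (k : ℤ) + 2 - 3 * n = ((k : ℤ) - 1 - 3 * n) + (3 : ℕ) := by push_cast; ring
      have e2 : (k : ℤ) + 2 - 3 * ((n + 1 : ℕ) : ℤ) = (k : ℤ) - 1 - 3 * n := by push_cast; ring
      rw [e1, zpow_add₀ hγ.ne', zpow_natCast] at hs
      have ht := mul_le_mul_of_nonneg_left (hD n) hw.le
      have hsum : -(M / (1 - γ ^ 3)) * γ ^ ((k : ℤ) - 1 - 3 * n) ≤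
          ∑ i ∈ Finset.range n, γ ^ ((k : ℤ) - 1 - 3 * i) * D i +
            γ ^ ((k : ℤ) - 1 - 3 * n) * D n := by
        have : -(M / (1 - γ ^ 3)) * γ ^ ((k : ℤ) - 1 - 3 * n) =
            -(M / (1 - γ ^ 3)) * (γ ^ ((k : ℤ) - 1 - 3 * n) * γ ^ 3) +
              γ ^ ((k : ℤ) - 1 - 3 * n) * -M := by
          field_simp
          ring
        linarith
      refine ⟨le_trans ?_ hsum, fun _ => by rw [e2]; exact hsum⟩
      have hone : γ ^ ((k : ℤ) - 1 - 3 * n) ≤ 1 := zpow_le_one₀ hγ hγ1.le (by omega)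
      have : 0 ≤ M / (1 - γ ^ 3) := by positivity
      nlinarith

/-- Solution of the linear recursion satisfied by the log-ratios of the policy iterates. -/
lemma log_ratio_eq_sum {γ : ℝ} (hγ : 0 < γ) {δ D : ℕ → ℝ} (h0 : δ 0 = 0)
    (hδ : ∀ k : ℕ, δ (k + 1) = γ * (δ k - γ ^ (-(2 * ((k : ℤ) + 1))) * D k)) (k : ℕ) :
    δ (k + 1) = -∑ i ∈ Finset.range (k + 1), γ ^ ((k : ℤ) - 1 - 3 * i) * D i := by
  have step : ∀ k : ℕ, γ * γ ^ (-(2 * ((k : ℤ) + 1))) = γ ^ ((k : ℤ) - 1 - 3 * k) := by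
    intro k
    rw [← zpow_one_add₀ hγ.ne']
    congr 1
    ring
  induction k with
  | zero =>
    rw [hδ, h0, Finset.sum_range_one, ← step]
    ring
  | succ k ih =>
    rw [hδ, ih, Finset.sum_range_succ _ (k + 1), ← step (k + 1)]
    have : ∀ i : ℕ, γ ^ (((k + 1 : ℕ) : ℤ) - 1 - 3 * i) = γ * γ ^ ((k : ℤ) - 1 - 3 * i) := by
      intro i
      rw [← zpow_one_add₀ hγ.ne']
      congr 1
      push_cast
      ring
    simp only [this, mul_assoc, ← Finset.mul_sum]
    ring

lemma half_le_poly {r : ℝ} (h0 : 0 ≤ r) (h1 : r ≤ 1) (h2 : 1 / 2 ≤ r ^ 2) :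
    1 / 2 ≤ (1 - r ^ 2) + (2 * r ^ 6 - r ^ 5) := by
  have h : 7 / 10 ≤ r := by nlinarith
  have h3 : 0 ≤ (r - 7 / 10) * (1 - r) := mul_nonneg (by linarith) (by linarith)
  nlinarith [sq_nonneg (r ^ 2 - 6 / 10), sq_nonneg (r ^ 2 - r * (8 / 10)), sq_nonneg (r - 8 / 10),
    sq_nonneg (r ^ 3 - r * (6 / 10)), mul_nonneg h3 h0, mul_nonneg h3 (sq_nonneg r),
    mul_nonneg h3 (pow_nonneg h0 3), mul_nonneg h3 (pow_nonneg h0 4)]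

/-- Lower bound for the weighted sum of the action gaps `D i` of the first `k + 1` iterates, given
that `r = γ ^ (k / 3)` controls the perturbation of the limiting gap `Δ`. -/
lemma weighted_gap_lower_bound {γ Δ H r : ℝ} (hγ : 0 < γ) (hγ1 : γ < 1) (hΔ : 0 < Δ)
    (hΔH : Δ ≤ H) (k : ℕ) (hr : 0 < r) (hrk : r ^ 3 = γ ^ k) {D : ℕ → ℝ}
    (hDH : ∀ i, -H ≤ D i) (hDr : ∀ i, Δ - Δ / r ≤ D i) (hDγ : ∀ i, Δ - Δ / r * γ ^ i ≤ D i) :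
    Δ * γ ^ (-(2 * (k : ℤ) + 1)) / 2 - H / ((1 - γ ^ 3) * γ) ≤
      ∑ i ∈ Finset.range (k + 1), γ ^ ((k : ℤ) - 1 - 3 * i) * D i := by
  have hr1 : r ≤ 1 := by
    by_contra! h
    have h1 := one_lt_pow₀ h (n := 3) (by norm_num)
    have h2 := pow_le_one₀ (n := k) hγ.le hγ1.le
    linarith
  have h3 : 0 < 1 - γ ^ 3 := by
    have := pow_lt_one₀ hγ.le hγ1 (n := 3) (by norm_num)
    linarith
  have hD0 : ∀ i < k, k ≤ 3 * i → 0 ≤ D i := by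
    intro i _ hi
    refine le_trans ?_ (hDγ i)
    have h1 : γ ^ i ≤ r := by
      refine le_of_pow_le_pow_left₀ (n := 3) (by norm_num) hr.le ?_
      rw [hrk, ← pow_mul]
      exact pow_le_pow_of_le_one hγ.le hγ1.le (by omega)
    have : Δ / r * γ ^ i ≤ Δ / r * r := by gcongr
    rw [div_mul_cancel₀ _ hr.ne'] at this
    linarith
  have hDk : Δ * (1 - r ^ 2) ≤ D k := by
    refine le_trans (le_of_eq ?_) (hDγ k)
    rw [← hrk]
    field_simp
  set w : ℝ := γ ^ (-(2 * (k : ℤ) + 1)) with hw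
  have hwpos : 0 < w := by positivity
  have hwr : w * γ * r ^ 6 = 1 := by
    have : r ^ 6 = γ ^ (2 * (k : ℤ)) := by
      rw [show r ^ 6 = (r ^ 3) ^ 2 by ring, hrk, ← pow_mul, mul_comm k 2]
      exact_mod_cast (zpow_natCast γ (2 * k)).symm
    rw [this, hw, mul_assoc, ← zpow_one_add₀ hγ.ne', ← zpow_add₀ hγ.ne']
    rw [show -(2 * (k : ℤ) + 1) + (1 + 2 * (k : ℤ)) = 0 by ring, zpow_zero]
  rw [Finset.sum_range_succ, show (k : ℤ) - 1 - 3 * k = -(2 * (k : ℤ) + 1) by ring, ← hw]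
  have hwD := mul_le_mul_of_nonneg_left hDk hwpos.le
  have hH : 0 < H := hΔ.trans_le hΔH
  rcases le_or_gt (r ^ 2) (1 / 2) with hcase | hcase
  · have hlow := neg_le_sum_zpow hγ hγ1 hH.le k hDH k hD0
    have hB : H / (1 - γ ^ 3) ≤ H / ((1 - γ ^ 3) * γ) := by
      gcongr
      nlinarith
    have : w * (Δ * (1 / 2)) ≤ w * (Δ * (1 - r ^ 2)) := by
      gcongr
      linarith
    linarith
  · have hM : 0 ≤ Δ / r - Δ := by
      rw [sub_nonneg, le_div_iff₀ hr]
      nlinarith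
    have hlow := neg_le_sum_zpow hγ hγ1 hM k (fun i => by linarith [hDr i]) k hD0
    have hpoly := half_le_poly hr.le hr1 hcase.le
    have hrr : Δ / r ≤ 2 * Δ := by
      rw [div_le_iff₀ hr]
      nlinarith
    have h6 : γ⁻¹ * (2 * Δ - Δ / r) ≤ H / ((1 - γ ^ 3) * γ) - (Δ / r - Δ) / (1 - γ ^ 3) := by
      have e : H / ((1 - γ ^ 3) * γ) - (Δ / r - Δ) / (1 - γ ^ 3)
          = γ⁻¹ * ((H - γ * (Δ / r - Δ)) / (1 - γ ^ 3)) := by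
        field_simp
      rw [e]
      gcongr
      rw [le_div_iff₀ h3]
      have : 0 ≤ γ ^ 3 := by positivity
      nlinarith
    have h7 : γ⁻¹ * (2 * Δ - Δ / r) = w * (Δ * (2 * r ^ 6 - r ^ 5)) := by
      have : γ⁻¹ = w * r ^ 6 := by
        field_simp
        linarith
      rw [this]
      field_simp
    have h8 : w * (Δ * (1 / 2)) ≤ w * (Δ * ((1 - r ^ 2) + (2 * r ^ 6 - r ^ 5))) := by gcongr
    linarith

end Scalars

section MarkovDecisionProcess

variable {S A : Type*} [Fintype S] {γ : ℝ} {c : S → A → ℝ} {P : S → A → S → ℝ}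

lemma Qf_sub_Qf (V W : S → ℝ) (s : S) (a : A) :
    Qf γ c P V s a - Qf γ c P W s a = γ * ∑ s', P s a s' * (V s' - W s') := by
  simp only [Qf, mul_sub, Finset.sum_sub_distrib]
  ring

lemma abs_Qf_le (hγ : 0 < γ) (hγ1 : γ < 1) {C : ℝ} (hC : ∀ s a, |c s a| ≤ C)
    (hP : ∀ s a, IsDist (P s a)) {V : S → ℝ} (hV : ∀ s, |V s| ≤ C / (1 - γ)) (s : S) (a : A) :
    |Qf γ c P V s a| ≤ C / (1 - γ) := by
  have h1 := (hP s a).sum_mul_le (fun s' => (abs_le.1 (hV s')).2)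
  have h2 := (hP s a).le_sum_mul (fun s' => (abs_le.1 (hV s')).1)
  have h3 := abs_le.1 (hC s a)
  have h4 : C / (1 - γ) = C + γ * (C / (1 - γ)) := by
    have : 1 - γ ≠ 0 := by linarith
    field_simp
    ring
  rw [Qf, abs_le]
  constructor <;> nlinarith

variable [Fintype A]

/-- A subsolution of a discounted evaluation equation with bounded source term is bounded. -/
lemma le_div_of_discounted_le [Nonempty S] (hγ : 0 < γ) (hγ1 : γ < 1)
    (hP : ∀ s a, IsDist (P s a)) {π : S → A → ℝ} (hπ : IsPolicy π) {h : S → ℝ} {b : ℝ}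
    (hb : ∀ s, h s ≤ b + γ * ∑ a, π s a * ∑ s', P s a s' * h s') (s : S) :
    h s ≤ b / (1 - γ) := by
  obtain ⟨t, ht⟩ := Finite.exists_max h
  have h1 : ∑ a, π t a * ∑ s', P t a s' * h s' ≤ h t :=
    (hπ t).sum_mul_le fun a => (hP t a).sum_mul_le ht
  have h2 := hb t
  have h3 : h t ≤ b / (1 - γ) := by
    rw [le_div_iff₀ (by linarith)]
    nlinarith
  exact (ht s).trans h3

lemma sum_mul_Qf_sub (p : A → ℝ) (V W : S → ℝ) (s : S) :
    ∑ a, p a * Qf γ c P V s a - ∑ a, p a * Qf γ c P W s a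
      = γ * ∑ a, p a * ∑ s', P s a s' * (V s' - W s') := by
  rw [← Finset.sum_sub_distrib, Finset.mul_sum]
  refine Finset.sum_congr rfl fun a _ => ?_
  rw [← mul_sub, Qf_sub_Qf]
  ring

/-- Performance difference bound: a policy whose one-step lookahead on `W` exceeds `W` by at most
`b` has value at most `W + b / (1 - γ)`. -/
lemma value_sub_le [Nonempty S] (hγ : 0 < γ) (hγ1 : γ < 1)
    (hP : ∀ s a, IsDist (P s a)) {π : S → A → ℝ} (hπ : IsPolicy π) {V W : S → ℝ} {b : ℝ}
    (hV : ∀ s, V s = ∑ a, π s a * Qf γ c P V s a)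
    (hb : ∀ s, ∑ a, π s a * Qf γ c P W s a - W s ≤ b) (s : S) :
    V s - W s ≤ b / (1 - γ) := by
  refine le_div_of_discounted_le hγ hγ1 hP hπ (h := fun s => V s - W s) (fun s => ?_) s
  have := sum_mul_Qf_sub (γ := γ) (c := c) (P := P) (π s) V W s
  have := hV s
  have := hb s
  linarith

lemma abs_value_le [Nonempty S] (hγ : 0 < γ) (hγ1 : γ < 1) {C : ℝ} (hC : ∀ s a, |c s a| ≤ C)
    (hP : ∀ s a, IsDist (P s a)) {π : S → A → ℝ} (hπ : IsPolicy π) {V : S → ℝ}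
    (hV : ∀ s, V s = ∑ a, π s a * Qf γ c P V s a) (s : S) :
    |V s| ≤ C / (1 - γ) := by
  have hsplit : ∀ s, V s = ∑ a, π s a * c s a + γ * ∑ a, π s a * ∑ s', P s a s' * V s' := by
    intro s
    rw [hV s, Finset.mul_sum, ← Finset.sum_add_distrib]
    refine Finset.sum_congr rfl fun a _ => ?_
    rw [Qf]
    ring
  rw [abs_le]
  constructor
  · have h := le_div_of_discounted_le hγ hγ1 hP hπ (h := fun s => -V s) (b := C) (fun s => ?_) s
    · linarith
    · have h1 := (hπ s).le_sum_mul (h := c s) (fun a => (abs_le.1 (hC s a)).1)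
      have h2 := hsplit s
      simp only [mul_neg, Finset.sum_neg_distrib]
      linarith
  · refine le_div_of_discounted_le hγ hγ1 hP hπ (fun s => ?_) s
    have h1 := (hπ s).sum_mul_le (h := c s) (fun a => (abs_le.1 (hC s a)).2)
    have h2 := hsplit s
    linarith

/-- Bellman optimality equation for the value of an optimal policy. -/
lemma Qmin_eq_of_optimal [Nonempty S] [Nonempty A] (hγ : 0 < γ) (hγ1 : γ < 1)
    (hP : ∀ s a, IsDist (P s a)) {V : (S → A → ℝ) → S → ℝ}
    (hV : ∀ π, IsPolicy π → ∀ s, V π s = ∑ a, π s a * Qf γ c P (V π) s a)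
    {πstar : S → A → ℝ} (hπstar : IsPolicy πstar)
    (hoptimal : ∀ π', IsPolicy π' → ∀ s, V πstar s ≤ V π' s) (s : S) :
    Qmin (Qf γ c P (V πstar)) s = V πstar s := by
  classical
  set Q := Qf γ c P (V πstar) with hQ
  have hle : ∀ s, Qmin Q s ≤ V πstar s := by
    intro s
    rw [hV πstar hπstar s]
    exact (hπstar s).le_sum_mul fun a => Finset.inf'_le _ (Finset.mem_univ a)
  have hex : ∀ s, ∃ a, Qmin Q s = Q s a := fun s =>
    (Finset.exists_mem_eq_inf' Finset.univ_nonempty (Q s)).imp fun _ h => h.2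
  choose g hg using hex
  set π' : S → A → ℝ := fun s a => if a = g s then 1 else 0 with hπ'
  have hpol : IsPolicy π' := fun s =>
    ⟨fun a => by simp only [hπ']; split_ifs <;> norm_num, by simp [hπ']⟩
  have hsum : ∀ (W : S → ℝ) s, ∑ a, π' s a * Qf γ c P W s a = Qf γ c P W s (g s) := by
    intro W s
    simp [hπ']
  have hval : ∀ s, V π' s = V πstar s := by
    intro s
    have h := value_sub_le hγ hγ1 hP hpol (W := V πstar) (b := 0) (hV π' hpol)
      (fun s => by rw [hsum, ← hQ, ← hg]; linarith [hle s]) s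
    have h2 := hoptimal π' hpol s
    rw [zero_div] at h
    linarith
  have h := hV π' hpol s
  rw [hsum, hval s, show V π' = V πstar from funext hval, ← hQ, ← hg] at h
  exact h.symm

/-- Averaging against the stationary distribution of a policy is invariant under its
transitions. -/
lemma sum_stationary {π : S → A → ℝ} {ν : S → ℝ}
    (hν : ∀ s', ν s' = ∑ s, ν s * ∑ a, π s a * P s a s') (h : S → ℝ) :
    ∑ s, ν s * ∑ a, π s a * ∑ s', P s a s' * h s' = ∑ s, ν s * h s := by
  have h1 : ∀ s, ν s * ∑ a, π s a * ∑ s', P s a s' * h s'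
      = ∑ s', (ν s * ∑ a, π s a * P s a s') * h s' := by
    intro s
    simp only [Finset.mul_sum, Finset.sum_mul, mul_assoc]
    exact Finset.sum_comm
  simp only [h1]
  rw [Finset.sum_comm]
  refine Finset.sum_congr rfl fun t _ => ?_
  rw [← Finset.sum_mul, ← hν t]

/-- The distribution mismatch ratio dominates the discounted transition densities. -/
lemma mul_le_mismatch_mul [Nonempty S] [Nonempty A] (hγ : 0 < γ) {ν : S → ℝ}
    (hνpos : ∀ s, 0 < ν s) (s : S) (a : A) (s' : S) :
    γ * P s a s' ≤ γ * Finset.univ.sup' Finset.univ_nonempty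
        (fun x : S × A × S => P x.1 x.2.1 x.2.2 / ν x.2.2) * ν s' := by
  have h := Finset.le_sup' (fun x : S × A × S => P x.1 x.2.1 x.2.2 / ν x.2.2)
    (Finset.mem_univ (s, a, s'))
  rw [div_le_iff₀ (hνpos s')] at h
  rw [mul_assoc]
  exact mul_le_mul_of_nonneg_left h hγ.le

end MarkovDecisionProcess

section PolicyMirrorDescent

variable {S A : Type*} [Fintype S] [Fintype A] [Nonempty A] {γ : ℝ}
  {c : S → A → ℝ} {P : S → A → S → ℝ} {V : (S → A → ℝ) → S → ℝ} {π : ℕ → S → A → ℝ}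

/-- One step of policy mirror descent, compared at a state with an arbitrary distribution. -/
lemma pmd_step_le (hγ : 0 < γ) (hγ1 : γ < 1) (hpol : ∀ k, IsPolicy (π k))
    (hpos : ∀ k s a, 0 < π k s a)
    (hlog : ∀ (k : ℕ) s, ∃ κ : ℝ, ∀ a, Real.log (π (k + 1) s a) =
      γ * (Real.log (π k s a) - γ ^ (-(2 * ((k : ℤ) + 1))) * Qf γ c P (V (π k)) s a) + κ)
    (k : ℕ) (s : S) {p : A → ℝ} (hp : IsDist p) :
    ∑ a, π (k + 1) s a * Qf γ c P (V (π k)) s a - ∑ a, p a * Qf γ c P (V (π k)) s a ≤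
      γ ^ (2 * k + 1) * ((1 - γ) * Real.log (Fintype.card A) + γ * KL p (π k s)
        - KL p (π (k + 1) s)) := by
  obtain ⟨κ, hκ⟩ := hlog k s
  have h := mirror_step_le hγ hγ1 (hpos k s) (hpol k s) (hpos (k + 1) s) (hpol (k + 1) s) hp hκ
  have hw : γ ^ (2 * k + 1) * (γ * γ ^ (-(2 * ((k : ℤ) + 1)))) = 1 := by
    rw [← zpow_natCast, ← zpow_one_add₀ hγ.ne', ← zpow_add₀ hγ.ne']
    rw [show ((2 * k + 1 : ℕ) : ℤ) + (1 + -(2 * ((k : ℤ) + 1))) = 0 by push_cast; ring, zpow_zero]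
  have h' := mul_le_mul_of_nonneg_left h (pow_nonneg hγ.le (2 * k + 1))
  rwa [← mul_assoc, hw, one_mul] at h'

variable [Nonempty S]

/-- The value after one step exceeds the one-step lookahead by at most a regularization error. -/
lemma value_succ_le_lookahead (hγ : 0 < γ) (hγ1 : γ < 1) (hP : ∀ s a, IsDist (P s a))
    (hV : ∀ π, IsPolicy π → ∀ s, V π s = ∑ a, π s a * Qf γ c P (V π) s a)
    (hpol : ∀ k, IsPolicy (π k)) (hpos : ∀ k s a, 0 < π k s a)
    (hlog : ∀ (k : ℕ) s, ∃ κ : ℝ, ∀ a, Real.log (π (k + 1) s a) =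
      γ * (Real.log (π k s a) - γ ^ (-(2 * ((k : ℤ) + 1))) * Qf γ c P (V (π k)) s a) + κ)
    (k : ℕ) (s : S) :
    V (π (k + 1)) s ≤ ∑ a, π (k + 1) s a * Qf γ c P (V (π k)) s a
      + γ * (γ ^ (2 * k + 1) * Real.log (Fintype.card A)) := by
  have hstep : ∀ s, V (π (k + 1)) s - V (π k) s ≤
      γ ^ (2 * k + 1) * ((1 - γ) * Real.log (Fintype.card A)) / (1 - γ) := by
    refine value_sub_le hγ hγ1 hP (hpol (k + 1)) (hV _ (hpol (k + 1))) fun s => ?_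
    have h := pmd_step_le hγ hγ1 hpol hpos hlog k s (hpol k s)
    have h2 := mul_nonneg (pow_nonneg hγ.le (2 * k + 1))
      (KL_nonneg (hpol k s) (hpol (k + 1) s) (hpos (k + 1) s))
    rw [KL_self (hpos k s), ← hV _ (hpol k) s] at h
    linarith
  have hne : 1 - γ ≠ 0 := by linarith
  have h1 := sum_mul_Qf_sub (γ := γ) (c := c) (P := P) (π (k + 1) s) (V (π (k + 1))) (V (π k)) s
  rw [← hV _ (hpol (k + 1)) s] at h1
  have h2 := (hpol (k + 1) s).sum_mul_le fun a => (hP s a).sum_mul_le hstep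
  have h3 := mul_le_mul_of_nonneg_left h2 hγ.le
  rw [show γ ^ (2 * k + 1) * ((1 - γ) * Real.log (Fintype.card A)) / (1 - γ)
    = γ ^ (2 * k + 1) * Real.log (Fintype.card A) by field_simp] at h3
  linarith

/-- Global linear convergence of the optimality gap averaged over the stationary distribution of
an optimal policy. -/
lemma averaged_gap_le (hγ : 0 < γ) (hγ1 : γ < 1) (hP : ∀ s a, IsDist (P s a))
    (hV : ∀ π, IsPolicy π → ∀ s, V π s = ∑ a, π s a * Qf γ c P (V π) s a)
    {πstar : S → A → ℝ} (hπstar : IsPolicy πstar) {ν : S → ℝ} (hν : IsDist ν)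
    (hνstat : ∀ s', ν s' = ∑ s, ν s * ∑ a, πstar s a * P s a s')
    (hpol : ∀ k, IsPolicy (π k)) (hpos : ∀ k s a, 0 < π k s a)
    (hinit : ∀ s a, π 0 s a = 1 / (Fintype.card A : ℝ))
    (hlog : ∀ (k : ℕ) s, ∃ κ : ℝ, ∀ a, Real.log (π (k + 1) s a) =
      γ * (Real.log (π k s a) - γ ^ (-(2 * ((k : ℤ) + 1))) * Qf γ c P (V (π k)) s a) + κ)
    {G : ℝ} (hG : ∀ s, V (π 0) s - V πstar s ≤ G) (k : ℕ) :
    ∑ s, ν s * (V (π k) s - V πstar s) ≤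
      γ ^ k * (G + Real.log (Fintype.card A) + Real.log (Fintype.card A) / (1 - γ)) := by
  set L : ℝ := Real.log (Fintype.card A) with hL
  have hLnn : 0 ≤ L := Real.log_nonneg (by exact_mod_cast Fintype.card_pos)
  set d : ℕ → ℝ := fun k => ∑ s, ν s * (V (π k) s - V πstar s) with hd
  set X : ℕ → ℝ := fun k => ∑ s, ν s * KL (πstar s) (π k s) with hX
  have hXnn : ∀ k, 0 ≤ X k := fun k => Finset.sum_nonneg fun s _ =>
    mul_nonneg (hν.1 s) (KL_nonneg (hπstar s) (hpol k s) (hpos k s))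
  have hpt : ∀ k s, V (π (k + 1)) s - V πstar s ≤
      γ * ∑ a, πstar s a * ∑ s', P s a s' * (V (π k) s' - V πstar s')
        + γ ^ (2 * k + 1) * (L + γ * KL (πstar s) (π k s) - KL (πstar s) (π (k + 1) s)) := by
    intro k s
    have h1 := value_succ_le_lookahead hγ hγ1 hP hV hpol hpos hlog k s
    have h2 := pmd_step_le hγ hγ1 hpol hpos hlog k s (hπstar s)
    have h3 := sum_mul_Qf_sub (γ := γ) (c := c) (P := P) (πstar s) (V (π k)) (V πstar) s
    rw [← hV _ hπstar s] at h3
    linarith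
  have hrec : ∀ k, d (k + 1) ≤
      γ * d k + γ ^ (2 * k + 1) * (L + γ * X k - X (k + 1)) := by
    intro k
    have h1 : d (k + 1) ≤ _ :=
      Finset.sum_le_sum fun s _ => mul_le_mul_of_nonneg_left (hpt k s) (hν.1 s)
    have h2 := sum_stationary hνstat fun s => V (π k) s - V πstar s
    have h3 : ∀ s, ν s * (γ * ∑ a, πstar s a * ∑ s', P s a s' * (V (π k) s' - V πstar s')
        + γ ^ (2 * k + 1) * (L + γ * KL (πstar s) (π k s) - KL (πstar s) (π (k + 1) s)))
        = γ * (ν s * ∑ a, πstar s a * ∑ s', P s a s' * (V (π k) s' - V πstar s'))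
          + γ ^ (2 * k + 1) * (ν s * L + γ * (ν s * KL (πstar s) (π k s))
            - ν s * KL (πstar s) (π (k + 1) s)) := by
      intro s; ring
    simp only [h3, Finset.sum_add_distrib, Finset.sum_sub_distrib, ← Finset.mul_sum, h2,
      ← Finset.sum_mul, hν.2, one_mul] at h1
    exact h1
  have hE := le_geom_of_recursion hγ hγ1 hLnn (E := fun k => d k + γ ^ (2 * k) * X k)
    (fun k => by
      have h1 := hrec k
      have h2 : γ ^ (2 * (k + 1)) * X (k + 1) ≤ γ ^ (2 * k + 1) * X (k + 1) :=
        mul_le_mul_of_nonneg_right (pow_le_pow_of_le_one hγ.le hγ1.le (by omega)) (hXnn _)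
      have h3 : γ * (γ ^ (2 * k + 1) * X k) ≤ γ ^ (2 * k + 1) * X k :=
        mul_le_of_le_one_left (mul_nonneg (pow_nonneg hγ.le _) (hXnn k)) hγ1.le
      have h4 : γ * (γ ^ (2 * k) * X k) = γ ^ (2 * k + 1) * X k := by ring
      linarith) k
  have hd0 : d 0 ≤ G := hν.sum_mul_le hG
  have hX0 : X 0 ≤ L := hν.sum_mul_le fun s => by
    rw [KL_eq_sub (hpos 0 s)]
    simp only [hinit, ← Finset.sum_mul, (hπstar s).2, one_div, Real.log_inv, ← hL]
    linarith [(hπstar s).sum_mul_log_nonpos]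
  have h5 : 0 ≤ γ ^ (2 * k) * X k := mul_nonneg (pow_nonneg hγ.le _) (hXnn k)
  have h6 : γ ^ k * (d 0 + γ ^ (2 * 0) * X 0 + L / (1 - γ)) ≤ γ ^ k * (G + L + L / (1 - γ)) := by
    have : γ ^ (2 * 0) * X 0 = X 0 := by simp
    rw [this]
    gcongr
  linarith

end PolicyMirrorDescent

/-- local superlinear convergence of the optimality gap for linearly
converging HPMD (Corollary 1). -/
theorem stmt11 {S A : Type*} [Fintype S] [Nonempty S] [Fintype A] [Nonempty A]
    (γ : ℝ) (hγ : 0 < γ ∧ γ < 1)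
    (C : ℝ) (c : S → A → ℝ) (hC : ∀ s a, |c s a| ≤ C)
    (P : S → A → S → ℝ) (hP : ∀ s a, IsDist (P s a))
    (V : (S → A → ℝ) → S → ℝ)
    (hV : ∀ π, IsPolicy π → ∀ s, V π s = ∑ a, π s a * Qf γ c P (V π) s a)
    (πstar : S → A → ℝ) (hπstar : IsPolicy πstar)
    (hoptimal : ∀ π', IsPolicy π' → ∀ s, V πstar s ≤ V π' s)
    (ν : S → ℝ) (hν : IsDist ν) (hνpos : ∀ s, 0 < ν s)
    (hνstat : ∀ s', ν s' = ∑ s, ν s * ∑ a, πstar s a * P s a s')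
    -- Q* = Q^{π*}
    (Qst : S → A → ℝ) (hQst : Qst = Qf γ c P (V πstar))
    -- the distribution mismatch ratio ϱ = γ·max_{s,a,s'} P(s'|s,a)/ν*(s')
    (ϱ : ℝ)
    (hϱ : ϱ = γ * Finset.univ.sup' Finset.univ_nonempty
        (fun x : S × A × S => P x.1 x.2.1 x.2.2 / ν x.2.2))
    -- the gap value Δ*(M)
    (Δ : ℝ)
    (hΔlb : ∀ s a, Qst s a ≠ Qmin Qst s → Δ ≤ Qst s a - Qmin Qst s)
    (hΔmem : ∃ s a, Qst s a ≠ Qmin Qst s ∧ Δ = Qst s a - Qmin Qst s)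
    -- HPMD parameters: 1 + η_k τ_k = 1/γ and η_k = γ^{−2(k+1)}
    (η τ : ℕ → ℝ)
    (hparam : ∀ k, 1 + η k * τ k = 1 / γ)
    (hηdef : ∀ k, η k = γ ^ (-(2 * ((k : ℤ) + 1))))
    -- HPMD iterates
    (π : ℕ → S → A → ℝ) (hpol : ∀ k, IsPolicy (π k))
    (hinit : ∀ s a, π 0 s a = 1 / (Fintype.card A : ℝ))
    (hstep : ∀ k s, ∀ p : A → ℝ, IsDist p →
      η k * ((∑ a, Qf γ c P (V (π k)) s a * π (k+1) s a) + τ k * KL (π (k+1) s) (π 0 s))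
          + KL (π (k+1) s) (π k s) ≤
      η k * ((∑ a, Qf γ c P (V (π k)) s a * p a) + τ k * KL p (π 0 s)) + KL p (π k s)) :
    ∀ k : ℕ,
      3 * (Real.log (Δ * (1 - γ) / (2 * ϱ * (4 * Real.log (Fintype.card A : ℝ) + C)))
            / Real.log γ) ≤ (k : ℝ) →
      (∀ s, V (π (k+1)) s - V πstar s ≤
        (2 * C * (Fintype.card A : ℝ) * Real.exp (2 * C / ((1 - γ ^ 3) * (1 - γ) * γ))
            / (1 - γ) ^ 2) *
          Real.exp (-(Δ * γ ^ (-(2 * (k : ℤ) + 1)) / 2))) ∧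
      (∑ s, ν s * V (π (k+1)) s) - (∑ s, ν s * V πstar s) ≤
        (2 * C * (Fintype.card A : ℝ) * Real.exp (2 * C / ((1 - γ ^ 3) * (1 - γ) * γ))
            / (1 - γ) ^ 2) *
          Real.exp (-(Δ * γ ^ (-(2 * (k : ℤ) + 1)) / 2)) := by
  obtain ⟨hγ, hγ1⟩ := hγ
  intro k hk
  have h1γ : 0 < 1 - γ := by linarith
  set L : ℝ := Real.log (Fintype.card A) with hL
  have hcard : (0 : ℝ) < Fintype.card A := by exact_mod_cast Fintype.card_pos
  have hLnn : 0 ≤ L := Real.log_nonneg (by exact_mod_cast Fintype.card_pos)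
  -- closed form of the iterates
  have hupd : ∀ k, (∀ s a, 0 < π k s a) → ∀ s, (∀ a, 0 < π (k + 1) s a) ∧
      ∃ κ : ℝ, ∀ a, Real.log (π (k + 1) s a) =
        γ * (Real.log (π k s a) - γ ^ (-(2 * ((k : ℤ) + 1))) * Qf γ c P (V (π k)) s a) + κ := by
    intro k hpos s
    have h := exists_log_eq_of_isMinimizer hγ (u := 1 / (Fintype.card A : ℝ)) (by positivity)
      (hparam k) (Qf γ c P (V (π k)) s) (π k s) (π (k + 1) s) (π 0 s) (hinit s) (hpos s)
      (hpol (k + 1) s) (hstep k s)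
    rwa [hηdef k] at h
  have hpos : ∀ k s a, 0 < π k s a := by
    intro k
    induction k with
    | zero => intro s a; rw [hinit]; positivity
    | succ k ih => exact fun s => (hupd k ih s).1
  have hlog := fun k s => (hupd k (hpos k) s).2
  -- uniform bounds
  set H : ℝ := 2 * C / (1 - γ) with hH
  have hHC : H = C / (1 - γ) + C / (1 - γ) := by rw [hH]; ring
  have hVb : ∀ π, IsPolicy π → ∀ s, |V π s| ≤ C / (1 - γ) := fun π hπ =>
    abs_value_le hγ hγ1 hC hP hπ (hV π hπ)
  have hQb : ∀ π, IsPolicy π → ∀ s a, |Qf γ c P (V π) s a| ≤ C / (1 - γ) := fun π hπ =>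
    abs_Qf_le hγ hγ1 hC hP (hVb π hπ)
  have hQH : ∀ π, IsPolicy π → ∀ s a a',
      Qf γ c P (V π) s a - Qf γ c P (V π) s a' ≤ H := by
    intro π hπ s a a'
    linarith [(abs_le.1 (hQb π hπ s a)).2, (abs_le.1 (hQb π hπ s a')).1]
  have hgH : ∀ i s, V (π i) s - V πstar s ≤ H := by
    intro i s
    linarith [(abs_le.1 (hVb _ (hpol i) s)).2, (abs_le.1 (hVb _ hπstar s)).1]
  have hg0 : ∀ i s, 0 ≤ V (π i) s - V πstar s := fun i s =>
    sub_nonneg.2 (hoptimal _ (hpol i) s)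
  have hQmin : ∀ s, Qmin Qst s = V πstar s := by
    rw [hQst]
    exact Qmin_eq_of_optimal hγ hγ1 hP hV hπstar hoptimal
  have hmin : ∀ s, ∃ a, Qmin Qst s = Qst s a := fun s =>
    (Finset.exists_mem_eq_inf' Finset.univ_nonempty (Qst s)).imp fun _ h => h.2
  have hΔ : 0 < Δ ∧ Δ ≤ H := by
    obtain ⟨s, a, hne, rfl⟩ := hΔmem
    have hle : Qmin Qst s ≤ Qst s a := Finset.inf'_le _ (Finset.mem_univ a)
    refine ⟨sub_pos.2 (lt_of_le_of_ne hle hne.symm), ?_⟩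
    obtain ⟨a', ha'⟩ := hmin s
    rw [ha', hQst]
    exact hQH _ hπstar s a a'
  have hC0 : 0 < C := by
    have : 0 < 2 * C / (1 - γ) := hΔ.1.trans_le hΔ.2
    rw [lt_div_iff₀ h1γ] at this
    linarith
  -- the mismatch ratio
  have hϱP : ∀ s a s', γ * P s a s' ≤ ϱ * ν s' := by
    rw [hϱ]
    exact mul_le_mismatch_mul hγ hνpos
  have hϱγ : γ ≤ ϱ := by
    have s : S := Classical.arbitrary S
    have a : A := Classical.arbitrary A
    have h := Finset.sum_le_sum fun s' (_ : s' ∈ Finset.univ) => hϱP s a s'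
    rwa [← Finset.mul_sum, ← Finset.mul_sum, (hP s a).2, hν.2, mul_one, mul_one] at h
  have hϱpos : 0 < ϱ := hγ.trans_le hϱγ
  have hd := averaged_gap_le hγ hγ1 hP hV hπstar hν hνstat hpol hpos hinit hlog (hgH 0)
  -- the threshold on `k`
  set r : ℝ := γ ^ ((k : ℝ) / 3) with hr
  have hrpos : 0 < r := Real.rpow_pos_of_pos hγ _
  have hrk : r ^ 3 = γ ^ k := by
    rw [hr, ← Real.rpow_natCast, ← Real.rpow_mul hγ.le, ← Real.rpow_natCast]
    congr 1
    push_cast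
    ring
  have hrΔ : ϱ * (2 * (4 * L + C) / (1 - γ)) ≤ Δ / r := by
    have hx : 0 < Δ * (1 - γ) / (2 * ϱ * (4 * L + C)) :=
      div_pos (mul_pos hΔ.1 h1γ) (by positivity)
    have h1 : r ≤ Δ * (1 - γ) / (2 * ϱ * (4 * L + C)) := by
      rw [← Real.log_le_log_iff hrpos hx, hr, Real.log_rpow hγ]
      have h2 : Real.log (Δ * (1 - γ) / (2 * ϱ * (4 * L + C))) / Real.log γ ≤ (k : ℝ) / 3 := by
        linarith
      rwa [div_le_iff_of_neg (Real.log_neg hγ hγ1)] at h2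
    rw [le_div_iff₀ (by positivity)] at h1
    rw [le_div_iff₀ hrpos, mul_div_assoc', div_mul_eq_mul_div, div_le_iff₀ h1γ]
    linarith
  -- suboptimal actions have small probability
  set B : ℝ := 2 * C / ((1 - γ ^ 3) * (1 - γ) * γ) with hB
  set ε : ℝ := Real.exp B * Real.exp (-(Δ * γ ^ (-(2 * (k : ℤ) + 1)) / 2)) with hε
  have hprob : ∀ s a, Qst s a ≠ Qmin Qst s → π (k + 1) s a ≤ ε := by
    intro s a ha
    obtain ⟨a', ha'⟩ := hmin s
    have hgap := hΔlb s a ha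
    rw [ha', hQst] at hgap
    set D : ℕ → ℝ := fun i => Qf γ c P (V (π i)) s a - Qf γ c P (V (π i)) s a' with hD
    have hDerr : ∀ i, Δ - γ * ∑ s', P s a' s' * (V (π i) s' - V πstar s') ≤ D i := by
      intro i
      have e1 := Qf_sub_Qf (γ := γ) (c := c) (P := P) (V (π i)) (V πstar) s a
      have e2 := Qf_sub_Qf (γ := γ) (c := c) (P := P) (V (π i)) (V πstar) s a'
      have e3 := mul_nonneg hγ.le ((hP s a).le_sum_mul (hg0 i))
      simp only [hD]
      linarith
    have hDH : ∀ i, -H ≤ D i := by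
      intro i
      have := hQH _ (hpol i) s a' a
      simp only [hD]
      linarith
    have hDr : ∀ i, Δ - Δ / r ≤ D i := by
      intro i
      have e1 := mul_le_mul_of_nonneg_left ((hP s a').sum_mul_le (hgH i)) hγ.le
      have e2 : γ * H ≤ ϱ * (2 * (4 * L + C) / (1 - γ)) := by
        rw [hH]
        gcongr
        linarith
      linarith [hDerr i]
    have hDγ : ∀ i, Δ - Δ / r * γ ^ i ≤ D i := by
      intro i
      have e1 : γ * ∑ s', P s a' s' * (V (π i) s' - V πstar s') ≤
          ϱ * ∑ s', ν s' * (V (π i) s' - V πstar s') := by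
        rw [Finset.mul_sum, Finset.mul_sum]
        refine Finset.sum_le_sum fun s' _ => ?_
        rw [← mul_assoc, ← mul_assoc]
        exact mul_le_mul_of_nonneg_right (hϱP s a' s') (hg0 i s')
      have e2 : H + L + L / (1 - γ) ≤ 2 * (4 * L + C) / (1 - γ) := by
        have : L ≤ L / (1 - γ) := by
          rw [le_div_iff₀ h1γ]
          nlinarith
        have e : 2 * (4 * L + C) / (1 - γ) = H + 8 * (L / (1 - γ)) := by rw [hH]; ring
        linarith
      have e3 : ϱ * ∑ s', ν s' * (V (π i) s' - V πstar s') ≤ Δ / r * γ ^ i := by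
        calc _ ≤ ϱ * (γ ^ i * (2 * (4 * L + C) / (1 - γ))) := by
              gcongr
              exact (hd i).trans (by gcongr)
          _ = ϱ * (2 * (4 * L + C) / (1 - γ)) * γ ^ i := by ring
          _ ≤ Δ / r * γ ^ i := by gcongr
      linarith [hDerr i]
    have hsum := weighted_gap_lower_bound hγ hγ1 hΔ.1 hΔ.2 k hrpos hrk hDH hDr hDγ
    have hratio := log_ratio_eq_sum hγ (D := D)
      (δ := fun j => Real.log (π j s a) - Real.log (π j s a'))
      (by simp only [hinit, sub_self])
      (fun j => by
        obtain ⟨κ, hκ⟩ := hlog j s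
        simp only [hκ, hD]
        ring) k
    have hBH : H / ((1 - γ ^ 3) * γ) = B := by
      rw [hH, hB, div_div]
      congr 1
      ring
    have hlog0 := Real.log_nonpos (hpos (k + 1) s a').le ((hpol (k + 1) s).le_one a')
    rw [hε, ← Real.exp_add, ← Real.log_le_iff_le_exp (hpos (k + 1) s a)]
    linarith
  have hεpos : 0 < ε := by positivity
  have hmain : ∀ s, V (π (k + 1)) s - V πstar s ≤ Fintype.card A * (ε * H) / (1 - γ) := by
    refine value_sub_le hγ hγ1 hP (hpol (k + 1)) (hV _ (hpol (k + 1))) fun s => ?_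
    rw [← (hpol (k + 1) s).sum_mul_sub, ← nsmul_eq_mul, ← Finset.card_univ]
    refine Finset.sum_le_card_nsmul _ _ _ fun a _ => ?_
    have hHnn : 0 ≤ H := hΔ.1.le.trans hΔ.2
    rw [← hQst, ← hQmin s]
    by_cases ha : Qst s a = Qmin Qst s
    · rw [ha, sub_self, mul_zero]
      positivity
    · refine mul_le_mul (hprob s a ha) ?_ (hΔ.1.le.trans (hΔlb s a ha)) hεpos.le
      obtain ⟨a', ha'⟩ := hmin s
      rw [ha', hQst]
      exact hQH _ hπstar s a a'
  have hconst : Fintype.card A * (ε * H) / (1 - γ) =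
      (2 * C * (Fintype.card A : ℝ) * Real.exp B / (1 - γ) ^ 2) *
          Real.exp (-(Δ * γ ^ (-(2 * (k : ℤ) + 1)) / 2)) := by
    rw [hε, hH]
    field_simp
  rw [← hconst]
  refine ⟨hmain, ?_⟩
  rw [← Finset.sum_sub_distrib]
  simp only [← mul_sub]
  exact hν.sum_mul_le hmain
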